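/- arXiv:0912.5072 — 2 statements merged into one kernel-verified Lean document; each statement's English description precedes it below -/
import Mathlib

section
/- Let ε = 1 and m = 3. For every even integer d with d > 0 and d ∣ 2D, one has C_d(ℚ₂) ≠ ∅ if and only if d − D(p+4) + 4D²/d ≡ 1 (mod 8). -/
/-- `CdPoints K m p q D d` says the curve `C_d` (with ε = 1), given by the homogeneous
equation `d w² = d² u⁴ - 2(p+q)D d u² z² + 4^m D² z⁴`, has a point over `K`. -/
def CdPoints (K : Type) [Field K] (m : ℕ) (p q D d : ℤ) : Prop :=
  ∃ u z w : K, ¬(u = 0 ∧ z = 0) ∧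
    (d : K) * w ^ 2 =
      (d : K) ^ 2 * u ^ 4 - 2 * ((p : K) + (q : K)) * (D : K) * (d : K) * u ^ 2 * z ^ 2
        + (4 : K) ^ m * (D : K) ^ 2 * z ^ 4

/-- `Cd'Points K p q D d` says the curve `C′_d` (with ε = 1), given by the homogeneous
equation `d w² = d² u⁴ + (p+q)D d u² z² + pq D² z⁴`, has a point over `K`. -/
def Cd'Points (K : Type) [Field K] (p q D d : ℤ) : Prop :=
  ∃ u z w : K, ¬(u = 0 ∧ z = 0) ∧
    (d : K) * w ^ 2 =
      (d : K) ^ 2 * u ^ 4 + ((p : K) + (q : K)) * (D : K) * (d : K) * u ^ 2 * z ^ 2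
        + (p : K) * (q : K) * (D : K) ^ 2 * z ^ 4

theorem PadicInt.exists_eq_two_mul_or (x : ℤ_[2]) : ∃ y, x = 2 * y ∨ x = 2 * y + 1 := by
  have hlt := x.zmodRepr_lt_p
  have hmem := x.sub_zmodRepr_mem
  rw [PadicInt.maximalIdeal_eq_span_p, Ideal.mem_span_singleton] at hmem
  obtain ⟨y, hy⟩ := hmem
  push_cast at hy
  refine ⟨y, ?_⟩
  obtain h | h : x.zmodRepr = 0 ∨ x.zmodRepr = 1 := by omega
  · left
    rw [h] at hy
    push_cast at hy
    linear_combination hy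
  · right
    rw [h] at hy
    push_cast at hy
    linear_combination hy

theorem PadicInt.two_mul_ne_one (x : ℤ_[2]) : 2 * x ≠ 1 := by
  intro h
  have h1 : ((2 : ℕ) : ℤ_[2]) ^ 1 ∣ ((1 : ℤ) : ℤ_[2]) := ⟨x, by push_cast; linear_combination -h⟩
  rw [PadicInt.pow_p_dvd_int_iff] at h1
  norm_num at h1

theorem PadicInt.exists_odd_sq_eq (y : ℤ_[2]) : ∃ a, (2 * y + 1) ^ 2 = 1 + 8 * a := by
  obtain ⟨t, rfl | rfl⟩ := y.exists_eq_two_mul_or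
  · exact ⟨2 * t ^ 2 + t, by ring⟩
  · exact ⟨2 * t ^ 2 + 3 * t + 1, by ring⟩

theorem PadicInt.exists_sq_eq_one_add_eight_mul (k : ℤ_[2]) : ∃ s : ℤ_[2], s ^ 2 = 1 + 8 * k := by
  open Polynomial in
  obtain ⟨y, hy, -⟩ := hensels_lemma (p := 2) (R := ℤ_[2])
    (F := (X ^ 2 + X - C (2 * k) : ℤ_[2][X])) (a := 0) (by
      have h : ‖(2 : ℤ_[2]) * k‖ < 1 := by
        rw [PadicInt.norm_lt_one_iff_dvd]
        exact ⟨k, by push_cast; rfl⟩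
      simpa using h)
  refine ⟨2 * y + 1, ?_⟩
  simp only [map_sub, map_add, map_pow, Polynomial.aeval_X, Polynomial.aeval_C] at hy
  simp only [Algebra.algebraMap_self, RingHom.id_apply] at hy
  linear_combination 4 * hy

/-- An integral point on `w² = 2e u⁴ - 4c u² z² + 32g z⁴` with `u` or `z` normalised to `1` forces
a congruence modulo `8` on the coefficients. -/
theorem eight_dvd_of_quartic_padicInt {e c g : ℤ} (he : Odd e) (hc : Odd c) (hg : Odd g)
    {u z w : ℤ_[2]} (huz : u = 1 ∨ z = 1)
    (h : w ^ 2 = 2 * (e : ℤ_[2]) * u ^ 4 - 4 * c * u ^ 2 * z ^ 2 + 32 * g * z ^ 4) :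
    (8 : ℤ) ∣ 2 * e - c + 2 * g - 1 := by
  obtain ⟨e', rfl⟩ := he
  obtain ⟨c', rfl⟩ := hc
  obtain ⟨g', rfl⟩ := hg
  push_cast at h
  obtain ⟨w₁, rfl | rfl⟩ := w.exists_eq_two_mul_or
  swap
  · exact absurd (by linear_combination -h) (PadicInt.two_mul_ne_one
      ((2 * (e' : ℤ_[2]) + 1) * u ^ 4 - 2 * (2 * c' + 1) * u ^ 2 * z ^ 2
        + 16 * (2 * g' + 1) * z ^ 4 - 2 * w₁ ^ 2 - 2 * w₁))
  have two_ne : (2 : ℤ_[2]) ≠ 0 := two_ne_zero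
  obtain ⟨u₁, rfl | rfl⟩ := u.exists_eq_two_mul_or
  swap
  · obtain ⟨a, ha⟩ := u₁.exists_odd_sq_eq
    have h' : 2 * w₁ ^ 2 = (2 * (e' : ℤ_[2]) + 1) * (1 + 8 * a) ^ 2
        - 2 * (2 * c' + 1) * (1 + 8 * a) * z ^ 2 + 16 * (2 * g' + 1) * z ^ 4 := by
      rw [← ha]
      apply mul_left_cancel₀ two_ne
      linear_combination h
    exact absurd (by linear_combination h') (PadicInt.two_mul_ne_one
      (w₁ ^ 2 - e' * (1 + 8 * a) ^ 2 - 8 * a - 32 * a ^ 2 + (2 * c' + 1) * (1 + 8 * a) * z ^ 2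
        - 8 * (2 * g' + 1) * z ^ 4))
  obtain rfl : z = 1 := huz.resolve_left (PadicInt.two_mul_ne_one u₁)
  have h₁ : w₁ ^ 2 = 2 * (4 * (2 * (e' : ℤ_[2]) + 1) * u₁ ^ 4
      - 2 * (2 * c' + 1) * u₁ ^ 2 + 4 * (2 * g' + 1)) := by
    apply mul_left_cancel₀ two_ne
    apply mul_left_cancel₀ two_ne
    linear_combination h
  obtain ⟨w₂, rfl | rfl⟩ := w₁.exists_eq_two_mul_or
  swap
  · exact absurd (by linear_combination -h₁) (PadicInt.two_mul_ne_one
      ((4 * (2 * (e' : ℤ_[2]) + 1) * u₁ ^ 4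
      - 2 * (2 * c' + 1) * u₁ ^ 2 + 4 * (2 * g' + 1)) - 2 * w₂ ^ 2 - 2 * w₂))
  have h₂ : w₂ ^ 2 = 2 * (2 * (e' : ℤ_[2]) + 1) * u₁ ^ 4 - (2 * c' + 1) * u₁ ^ 2
      + 2 * (2 * g' + 1) := by
    apply mul_left_cancel₀ two_ne
    apply mul_left_cancel₀ two_ne
    linear_combination h₁
  obtain ⟨u₂, rfl | rfl⟩ := u₁.exists_eq_two_mul_or
  · obtain ⟨w₃, rfl | rfl⟩ := w₂.exists_eq_two_mul_or
    · have h₃ : 2 * w₃ ^ 2 = 16 * (2 * (e' : ℤ_[2]) + 1) * u₂ ^ 4 - 2 * (2 * c' + 1) * u₂ ^ 2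
          + (2 * g' + 1) := by
        apply mul_left_cancel₀ two_ne
        linear_combination h₂
      exact absurd (by linear_combination h₃) (PadicInt.two_mul_ne_one
        (w₃ ^ 2 - 8 * (2 * (e' : ℤ_[2]) + 1) * u₂ ^ 4 + (2 * c' + 1) * u₂ ^ 2 - g'))
    · exact absurd (by linear_combination -h₂) (PadicInt.two_mul_ne_one
        (16 * (2 * (e' : ℤ_[2]) + 1) * u₂ ^ 4 - 2 * (2 * c' + 1) * u₂ ^ 2
          + (2 * g' + 1) - 2 * w₃ ^ 2 - 2 * w₃))
  obtain ⟨a, ha⟩ := u₂.exists_odd_sq_eq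
  rw [show (2 * u₂ + 1) ^ 4 = ((2 * u₂ + 1) ^ 2) ^ 2 by ring, ha] at h₂
  obtain ⟨w₃, rfl | rfl⟩ := w₂.exists_eq_two_mul_or
  · exact absurd (by linear_combination h₂) (PadicInt.two_mul_ne_one
      (2 * w₃ ^ 2 - (2 * (e' : ℤ_[2]) + 1) * (1 + 8 * a) ^ 2 + c' * (1 + 8 * a) + 4 * a
        - (2 * g' + 1) + 1))
  obtain ⟨b, hb⟩ := w₃.exists_odd_sq_eq
  have key : ((2 : ℕ) : ℤ_[2]) ^ 3 ∣
      ((2 * (2 * e' + 1) - (2 * c' + 1) + 2 * (2 * g' + 1) - 1 : ℤ) : ℤ_[2]) := by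
    refine ⟨b - 2 * (2 * (e' : ℤ_[2]) + 1) * (2 * a + 8 * a ^ 2) + (2 * c' + 1) * a, ?_⟩
    push_cast
    linear_combination hb - h₂
  rw [PadicInt.pow_p_dvd_int_iff] at key
  exact_mod_cast key

theorem Padic.norm_le_one_of_sq {x : ℚ_[2]} (h : ‖x ^ 2‖ ≤ 1) : ‖x‖ ≤ 1 := by
  rw [norm_pow] at h
  exact (pow_le_one_iff_of_nonneg (norm_nonneg x) two_ne_zero).mp h

theorem eight_dvd_of_quartic_padic {e c g : ℤ} (he : Odd e) (hc : Odd c) (hg : Odd g)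
    {u z w : ℚ_[2]} (huz : ¬(u = 0 ∧ z = 0))
    (h : w ^ 2 = 2 * (e : ℚ_[2]) * u ^ 4 - 4 * c * u ^ 2 * z ^ 2 + 32 * g * z ^ 4) :
    (8 : ℤ) ∣ 2 * e - c + 2 * g - 1 := by
  have integral (u z : ℤ_[2]) (w : ℚ_[2]) (huz : u = 1 ∨ z = 1)
      (h : w ^ 2 = 2 * (e : ℚ_[2]) * u ^ 4 - 4 * c * u ^ 2 * z ^ 2 + 32 * g * z ^ 4) :
      (8 : ℤ) ∣ 2 * e - c + 2 * g - 1 := by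
    have hw2 : w ^ 2 =
        ((2 * e * u ^ 4 - 4 * c * u ^ 2 * z ^ 2 + 32 * g * z ^ 4 : ℤ_[2]) : ℚ_[2]) := by
      rw [h]; push_cast; rfl
    have hw : ‖w‖ ≤ 1 := Padic.norm_le_one_of_sq (by rw [hw2]; exact PadicInt.norm_le_one _)
    obtain ⟨w, rfl⟩ : ∃ w' : ℤ_[2], (w' : ℚ_[2]) = w := ⟨⟨w, hw⟩, rfl⟩
    exact eight_dvd_of_quartic_padicInt he hc hg huz (w := w) (Subtype.ext hw2)
  rcases le_total ‖u‖ ‖z‖ with hle | hle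
  · have hz : z ≠ 0 := by
      rintro rfl
      exact huz ⟨by simpa using hle, rfl⟩
    have hn : ‖u / z‖ ≤ 1 := by rw [norm_div]; exact div_le_one_of_le₀ hle (norm_nonneg _)
    refine integral ⟨u / z, hn⟩ 1 (w / z ^ 2) (.inr rfl) ?_
    push_cast
    field_simp
    linear_combination h
  · have hu : u ≠ 0 := by
      rintro rfl
      exact huz ⟨rfl, by simpa using hle⟩
    have hn : ‖z / u‖ ≤ 1 := by rw [norm_div]; exact div_le_one_of_le₀ hle (norm_nonneg _)
    refine integral 1 ⟨z / u, hn⟩ (w / u ^ 2) (.inl rfl) ?_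
    push_cast
    field_simp
    linear_combination h

theorem stmt3
    (m : ℕ) (hm : 1 ≤ m)
    (p q : ℕ) (hp : p.Prime) (hq : q.Prime) (hpodd : Odd p) (hqodd : Odd q)
    (hpq : (q : ℤ) - (p : ℤ) = 2 ^ m)
    (D : ℤ) (hD0 : 0 < D) (hDsf : Squarefree D) (hDodd : Odd D)
    (hpD : ¬((p : ℤ) ∣ D)) (hqD : ¬((q : ℤ) ∣ D))
    (hm3 : m = 3)
    (d : ℤ) (hde : Even d) (hd0 : 0 < d) (hdD : d ∣ 2 * D) :
    CdPoints ℚ_[2] m (p : ℤ) (q : ℤ) D d ↔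
      d - D * ((p : ℤ) + 4) + 4 * D ^ 2 / d ≡ 1 [ZMOD 8] := by
  subst hm3
  obtain ⟨e, rfl⟩ : ∃ e, d = 2 * e := hde.two_dvd
  obtain ⟨f, rfl⟩ : e ∣ D := (mul_dvd_mul_iff_left two_ne_zero).mp hdD
  obtain ⟨he, hf⟩ := Int.odd_mul.mp hDodd
  have he0 : e ≠ 0 := by rintro rfl; simp at hd0
  have hdiv : 4 * (e * f) ^ 2 / (2 * e) = 2 * (e * f ^ 2) :=
    Int.ediv_eq_of_eq_mul_right (by simpa using he0) (by ring)
  have hc : Odd (e * f * ((p : ℤ) + 4)) :=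
    hDodd.mul (((Int.odd_coe_nat p).mpr hpodd).add_even (by decide))
  have hqp : (q : ℚ_[2]) = p + 8 := by
    have : (q : ℤ) = p + 8 := by linarith
    exact_mod_cast this
  have he0' : (e : ℚ_[2]) ≠ 0 := by exact_mod_cast he0
  rw [hdiv, Int.modEq_comm, Int.modEq_iff_dvd]
  constructor
  · rintro ⟨u, z, w, huz, h⟩
    refine eight_dvd_of_quartic_padic he hc (he.mul hf.pow) huz (w := w) ?_
    apply mul_left_cancel₀ (mul_ne_zero two_ne_zero he0')
    push_cast at h ⊢
    rw [hqp] at h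
    linear_combination h
  · rintro ⟨k, hk⟩
    obtain ⟨s, hs⟩ := PadicInt.exists_sq_eq_one_add_eight_mul k
    have hs' : (s : ℚ_[2]) ^ 2 = 1 + 8 * k := by exact_mod_cast congrArg (Subtype.val) hs
    have hk' : 2 * (e : ℚ_[2]) - e * f * (p + 4) + 2 * (e * f ^ 2) - 1 = 8 * k := by
      exact_mod_cast hk
    refine ⟨2, 1, 4 * s, by simp, ?_⟩
    push_cast
    rw [hqp]
    linear_combination 32 * (e : ℚ_[2]) * (hs' - hk')
end

section
/- Let ε = 1 and m = 2, and let d be a nonzero integer (positive or negative) with d ∣ pD. Then C′_d(ℚ₂) ≠ ∅ if and only if one of the following holds: (a) d ≡ 1 (mod 8); (b) pqD²/d ≡ 1 (mod 8); (c) d + pD ≡ 0 (mod 4); (d) d ≡ 3 (mod 4) and (p+2)D ≡ 1 (mod 8). -/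
/-- An integer congruent to `1` modulo `8` is a square in `ℚ_[2]`. -/
theorem exists_sq_eq_of_modEq_one (n : ℤ) (hn : n ≡ 1 [ZMOD 8]) : ∃ r : ℚ_[2], r ^ 2 = n := by
  obtain ⟨k, hk⟩ := hn.symm.dvd
  have hk' : (n : ℤ_[2]) = 1 + 2 ^ 3 * k := by
    have : n = 1 + 2 ^ 3 * k := by linarith
    rw [this]; push_cast; ring
  let F : Polynomial ℤ_[2] := Polynomial.X ^ 2 - Polynomial.C (n : ℤ_[2])
  have h2 : ‖(2 : ℤ_[2])‖ = 2⁻¹ := by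
    have := PadicInt.norm_p (p := 2)
    exact_mod_cast this
  have h8 : ‖F.aeval (1 : ℤ_[2])‖ < ‖F.derivative.aeval (1 : ℤ_[2])‖ ^ 2 := by
    have e1 : F.aeval (1 : ℤ_[2]) = -(2 ^ 3 * (k : ℤ_[2])) := by simp [F, hk']
    have e2 : F.derivative.aeval (1 : ℤ_[2]) = 2 := by simp [F, one_add_one_eq_two]
    rw [e1, e2, norm_neg, norm_mul, norm_pow, h2]
    have := PadicInt.norm_le_one (k : ℤ_[2])
    norm_num
    linarith
  obtain ⟨r, hr, -⟩ := hensels_lemma h8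
  refine ⟨r, ?_⟩
  have hr' : r ^ 2 = (n : ℤ_[2]) := by simpa [F, sub_eq_zero] using hr
  exact_mod_cast congrArg (Subtype.val) hr'

theorem four_mul_add_three_mul_sq_ne (i y : ZMod 32) :
    (4 * i + 3) * y ^ 2 ≠ 16 * i ^ 2 - 4 := by
  revert i y
  decide +kernel

theorem ZMod.sq_mod_eight_cases (x : ZMod 32) :
    (∃ s, x ^ 2 = 4 * s) ∨ ∃ t, x ^ 2 = 1 + 8 * t := by
  revert x
  decide +kernel

theorem ZMod.eight_mul_sq_ne (y : ZMod 32) : 8 * y ^ 2 ≠ 24 := by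
  revert y
  decide +kernel

/-- The quartic `y² = d x⁴ + 2 a x² + e` has no solution with `x` a `2`-adic integer. -/
theorem no_integral_point {d a e : ℤ} (hd : d % 4 = 3) (he : e % 4 = 3) (ha : a % 8 = 5)
    (hde : d * e ≡ a ^ 2 - 4 [ZMOD 32]) (x : ℤ_[2]) (y : ℚ_[2])
    (h : y ^ 2 = d * (x : ℚ_[2]) ^ 4 + 2 * a * (x : ℚ_[2]) ^ 2 + e) : False := by
  have hy : ‖y‖ ≤ 1 := by
    have h1 : y ^ 2 = ((d * x ^ 4 + 2 * a * x ^ 2 + e : ℤ_[2]) : ℚ_[2]) := by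
      rw [h]; push_cast; rfl
    have h2 : ‖y‖ ^ 2 ≤ 1 := by
      rw [← norm_pow, h1]; exact PadicInt.norm_le_one _
    exact (sq_le_one_iff₀ (norm_nonneg _)).1 h2
  obtain ⟨y, rfl⟩ : ∃ y' : ℤ_[2], (y' : ℚ_[2]) = y := ⟨⟨y, hy⟩, rfl⟩
  have h' : y ^ 2 = d * x ^ 4 + 2 * a * x ^ 2 + e :=
    Subtype.ext (by push_cast; exact h)
  have hz := congrArg (PadicInt.toZModPow (p := 2) 5) h'
  simp only [map_add, map_mul, map_pow, map_intCast, map_ofNat] at hz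
  generalize PadicInt.toZModPow (p := 2) 5 x = X at hz
  generalize PadicInt.toZModPow (p := 2) 5 y = Y at hz
  change ZMod 32 at X
  change ZMod 32 at Y
  change Y ^ 2 = (d : ZMod 32) * X ^ 4 + 2 * (a : ZMod 32) * X ^ 2 + (e : ZMod 32) at hz
  have hde' : (d : ZMod 32) * e = a ^ 2 - 4 := by
    have := (ZMod.intCast_eq_intCast_iff _ _ 32).2 hde
    exact_mod_cast this
  have h32 : (32 : ZMod 32) = 0 := by decide
  obtain ⟨i, rfl⟩ : ∃ i, d = 4 * i + 3 := ⟨d / 4, by omega⟩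
  obtain ⟨j, rfl⟩ : ∃ j, a = 8 * j + 5 := ⟨a / 8, by omega⟩
  obtain ⟨k, rfl⟩ : ∃ k, e = 4 * k + 3 := ⟨e / 4, by omega⟩
  push_cast at hz hde'
  generalize (i : ZMod 32) = i at *
  generalize (j : ZMod 32) = j at *
  generalize (k : ZMod 32) = k at *
  rcases ZMod.sq_mod_eight_cases X with ⟨s, hs⟩ | ⟨t, ht⟩
  · have hX : X ^ 4 = 16 * s ^ 2 := by linear_combination (X ^ 2 + 4 * s) * hs
    rw [hX, hs] at hz
    refine ZMod.eight_mul_sq_ne Y ?_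
    linear_combination 8 * hz +
      ((4 * i + 3) * 4 * s ^ 2 + 2 * (8 * j + 5) * s + k) * h32
  · have hX : X ^ 4 = 1 + 16 * t + 64 * t ^ 2 := by
      linear_combination (X ^ 2 + 1 + 8 * t) * ht
    rw [hX, ht] at hz
    refine four_mul_add_three_mul_sq_ne i Y ?_
    linear_combination (4 * i + 3) * hz + hde' + (4 * i + 3) *
      (2 * t ^ 2 * (4 * i + 3) + 2 * (i + 2 * j + 2) * t) * h32 +
      (2 * (j + 1) ^ 2 + 2 * i * (j + 1)) * h32

/-- If `d`, `e` and `a` satisfy the congruences of the insoluble case, then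
`y² = d u⁴ + 2 a u² z² + e z⁴` has no nontrivial point over `ℚ_[2]`. -/
theorem no_point {d a e : ℤ} (hd : d % 4 = 3) (he : e % 4 = 3) (ha : a % 8 = 5)
    (hde : d * e ≡ a ^ 2 - 4 [ZMOD 32]) (u z w : ℚ_[2]) (huz : ¬(u = 0 ∧ z = 0))
    (h : w ^ 2 = d * u ^ 4 + 2 * a * u ^ 2 * z ^ 2 + e * z ^ 4) : False := by
  rcases le_total ‖u‖ ‖z‖ with hle | hle
  · have hz : z ≠ 0 := by
      rintro rfl
      exact huz ⟨norm_le_zero_iff.1 (by simpa using hle), rfl⟩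
    have hx : ‖u / z‖ ≤ 1 := by
      rw [norm_div]; exact div_le_one_of_le₀ hle (norm_nonneg _)
    refine no_integral_point hd he ha hde ⟨u / z, hx⟩ (w / z ^ 2) ?_
    change _ = (d : ℚ_[2]) * (u / z) ^ 4 + 2 * a * (u / z) ^ 2 + e
    field_simp
    linear_combination h
  · have hu : u ≠ 0 := by
      rintro rfl
      exact huz ⟨rfl, norm_le_zero_iff.1 (by simpa using hle)⟩
    have hx : ‖z / u‖ ≤ 1 := by
      rw [norm_div]; exact div_le_one_of_le₀ hle (norm_nonneg _)
    refine no_integral_point he hd ha (by rwa [mul_comm]) ⟨z / u, hx⟩ (w / u ^ 2) ?_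
    change _ = (e : ℚ_[2]) * (z / u) ^ 4 + 2 * a * (z / u) ^ 2 + d
    field_simp
    linear_combination h

theorem Int.sq_emod_eight_of_odd {n : ℤ} (hn : n % 2 = 1) : n ^ 2 % 8 = 1 := by
  obtain h | h | h | h : n % 8 = 1 ∨ n % 8 = 3 ∨ n % 8 = 5 ∨ n % 8 = 7 := by omega
  all_goals simp [pow_two, Int.mul_emod, h]

theorem stmt13
    (m : ℕ) (hm : 1 ≤ m)
    (p q : ℕ) (hp : p.Prime) (hq : q.Prime) (hpodd : Odd p) (hqodd : Odd q)
    (hpq : (q : ℤ) - (p : ℤ) = 2 ^ m)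
    (D : ℤ) (hD0 : 0 < D) (hDsf : Squarefree D) (hDodd : Odd D)
    (hpD : ¬((p : ℤ) ∣ D)) (hqD : ¬((q : ℤ) ∣ D))
    (hm2 : m = 2)
    (d : ℤ) (hd0 : d ≠ 0) (hdD : d ∣ (p : ℤ) * D) :
    Cd'Points ℚ_[2] (p : ℤ) (q : ℤ) D d ↔
      (d ≡ 1 [ZMOD 8] ∨
        (p : ℤ) * (q : ℤ) * D ^ 2 / d ≡ 1 [ZMOD 8] ∨
        d + (p : ℤ) * D ≡ 0 [ZMOD 4] ∨
        (d ≡ 3 [ZMOD 4] ∧ ((p : ℤ) + 2) * D ≡ 1 [ZMOD 8])) := by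
  have hpq4 : (q : ℤ) = p + 4 := by rw [hm2] at hpq; linarith
  have hqK : (q : ℚ_[2]) = p + 4 := by exact_mod_cast hpq4
  have hpZ : (p : ℤ) % 2 = 1 := by obtain ⟨k, hk⟩ := hpodd; omega
  have hDZ : D % 2 = 1 := Int.odd_iff.1 hDodd
  obtain ⟨c, hc⟩ := hdD
  have hdK : (d : ℚ_[2]) ≠ 0 := by exact_mod_cast hd0
  set e : ℤ := (p : ℤ) * q * D ^ 2 / d with he_def
  have he : d * e = p * q * D ^ 2 :=
    Int.mul_ediv_cancel' ⟨c * (q * D), by linear_combination (q * D : ℤ) * hc⟩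
  have heK : (d : ℚ_[2]) * e = p * (p + 4) * D ^ 2 := by
    rw [← hqK]; exact_mod_cast congrArg (Int.cast : ℤ → ℚ_[2]) he
  have hcurve (u z w : ℚ_[2]) :
      (d : ℚ_[2]) * w ^ 2 = (d : ℚ_[2]) ^ 2 * u ^ 4
          + (((p : ℤ) : ℚ_[2]) + ((q : ℤ) : ℚ_[2])) * (D : ℚ_[2]) * (d : ℚ_[2]) * u ^ 2 * z ^ 2
          + ((p : ℤ) : ℚ_[2]) * ((q : ℤ) : ℚ_[2]) * (D : ℚ_[2]) ^ 2 * z ^ 4 ↔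
        w ^ 2 = d * u ^ 4 + 2 * (((p + 2) * D : ℤ) : ℚ_[2]) * u ^ 2 * z ^ 2 + e * z ^ 4 := by
    push_cast
    rw [hqK]
    refine ⟨fun h => mul_left_cancel₀ hdK ?_, fun h => ?_⟩
    · linear_combination h - z ^ 4 * heK
    · linear_combination d * h + z ^ 4 * heK
  simp only [Cd'Points, hcurve]
  set a : ℤ := (p + 2) * D with ha_def
  have hDsq : D ^ 2 % 8 = 1 := Int.sq_emod_eight_of_odd hDZ
  have hde : d * e = a ^ 2 - 4 * D ^ 2 := by rw [he, hpq4, ha_def]; ring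
  have ha2 : a % 2 = 1 := by
    rw [ha_def, Int.mul_emod, hDZ]; omega
  have hasq : a ^ 2 % 8 = 1 := Int.sq_emod_eight_of_odd ha2
  have hde8 : (d * e) % 8 = 5 := by omega
  have hde32 : d * e ≡ a ^ 2 - 4 [ZMOD 32] := by
    unfold Int.ModEq; omega
  have hd2 : d % 2 = 1 := by
    by_contra hcon
    have : d % 2 = 0 := by omega
    have : (d * e) % 2 = 0 := by simp [Int.mul_emod, this]
    omega
  constructor
  · rintro ⟨u, z, w, huz, h⟩
    by_contra! hcon
    obtain ⟨h1, h2, h3, h4⟩ := hcon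
    have hpa : (p : ℤ) * D = a - 2 * D := by rw [ha_def]; ring
    rw [hpa] at h3
    unfold Int.ModEq at h1 h2 h3 h4
    have hd3 : d % 4 = 3 := by
      by_contra hne
      have hd5 : d % 8 = 5 := by omega
      have : (d * e) % 8 = (5 * (e % 8)) % 8 := by rw [Int.mul_emod, hd5]
      omega
    have he3 : e % 4 = 3 := by
      have : (d * e) % 4 = (3 * (e % 4)) % 4 := by rw [Int.mul_emod, hd3]
      omega
    have := h4 hd3
    exact no_point hd3 he3 (by omega) hde32 u z w huz h
  · rintro (h | h | h | ⟨h, h'⟩)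
    · obtain ⟨r, hr⟩ := exists_sq_eq_of_modEq_one d h
      exact ⟨1, 0, r, by simp, by simp [hr]⟩
    · obtain ⟨r, hr⟩ := exists_sq_eq_of_modEq_one e h
      exact ⟨0, 1, r, by simp, by simp [hr]⟩
    · have key (b : ℤ) (hb : b % 2 = 1) (hbd : (d + b) % 8 = 0)
          (hroot : d * b ^ 2 - 2 * a * d * b + e * d ^ 2 = 0) :
          ∃ u z w : ℚ_[2], ¬(u = 0 ∧ z = 0) ∧
            w ^ 2 = d * u ^ 4 + 2 * (a : ℚ_[2]) * u ^ 2 * z ^ 2 + e * z ^ 4 := by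
        have hbsq := Int.sq_emod_eight_of_odd hb
        obtain ⟨r, hr⟩ := exists_sq_eq_of_modEq_one (-d * b) (by
          obtain ⟨k, hk⟩ := Int.dvd_of_emod_eq_zero hbd
          have : -d * b = b ^ 2 - 8 * (k * b) := by linear_combination -b * hk
          unfold Int.ModEq; omega)
        have hrootK := congrArg (Int.cast : ℤ → ℚ_[2]) hroot
        push_cast at hrootK hr
        refine ⟨b, r, 0, fun hcon => ?_, ?_⟩
        · have : b = 0 := by exact_mod_cast hcon.1
          omega
        · linear_combination -(b : ℚ_[2]) ^ 2 * hrootK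
            - (2 * a * b ^ 2 + e * (r ^ 2 - d * b)) * hr
      have hpa : (p : ℤ) * D = a - 2 * D := by rw [ha_def]; ring
      rw [hpa] at h
      unfold Int.ModEq at h
      by_cases h8 : (d + (a - 2 * D)) % 8 = 0
      · exact key (a - 2 * D) (by omega) h8 (by linear_combination d * hde)
      · exact key (a + 2 * D) (by omega) (by omega) (by linear_combination d * hde)
    · have hf : (d + 2 * a + e) % 32 = 4 := by
        unfold Int.ModEq at h h'
        obtain ⟨i, hi⟩ : ∃ i, d = 4 * i + 3 := ⟨d / 4, by omega⟩
        obtain ⟨j, hj⟩ : ∃ j, a = 8 * j + 1 := ⟨a / 8, by omega⟩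
        obtain ⟨k, hk⟩ : ∃ k, D ^ 2 = 8 * k + 1 := ⟨D ^ 2 / 8, by omega⟩
        obtain ⟨l, hl⟩ : (2 : ℤ) ∣ i * (i - 1) := (Int.even_mul_pred_self i).two_dvd
        have hdvd : (2 : ℤ) ^ 5 ∣ d * (d + 2 * a + e - 4) := by
          refine ⟨l + i + 2 * j ^ 2 + 2 * (i + 1) * j - k, ?_⟩
          have : d * (d + 2 * a + e - 4) = (d + a) ^ 2 - 4 * D ^ 2 - 4 * d := by
            linear_combination hde
          rw [this, hi, hj, hk]
          linear_combination 16 * hl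
        have hcop : IsCoprime ((2 : ℤ) ^ 5) d :=
          IsCoprime.pow_left ⟨-(2 * i + 1), 1, by rw [hi]; ring⟩
        have := hcop.dvd_of_dvd_mul_left hdvd
        omega
      obtain ⟨g, hg⟩ : ∃ g, d + 2 * a + e = 4 * g := ⟨(d + 2 * a + e) / 4, by omega⟩
      obtain ⟨r, hr⟩ := exists_sq_eq_of_modEq_one g (by unfold Int.ModEq; omega)
      have hgK := congrArg (Int.cast : ℤ → ℚ_[2]) hg
      push_cast at hgK
      refine ⟨1, 1, 2 * r, by simp, ?_⟩
      linear_combination 4 * hr - hgK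
end
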